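/- arXiv:2505.01646 — 4 statements merged into one kernel-verified Lean document; each statement's English description precedes it below -/
import Mathlib

section
/- Let E and F be complex Banach spaces, let P : E ≃L[ℂ] E and Q : F ≃L[ℂ] F be continuous linear equivalences (invertible bounded operators with bounded inverses), and let R : F →L[ℂ] E and S : E →L[ℂ] F be continuous linear maps. Define the reflection operators T_E := P⁻¹ ∘ R ∘ Q⁻¹ ∘ S : E →L[ℂ] E and T_F := Q⁻¹ ∘ S ∘ P⁻¹ ∘ R : F →L[ℂ] F, and assume ‖T_E‖ < 1 and ‖T_F‖ < 1. Then the block operator 𝒮 : E × F → E × F, 𝒮(e, f) = (P e + R f, S e + Q f), is an invertible continuous linear map, and its inverse is given by the series, convergent in operator norm, 𝒮⁻¹(e, f) = ∑_{n=0}^∞ ( T_E^n (P⁻¹ e) − P⁻¹ (R (T_F^n (Q⁻¹ f))), −Q⁻¹ (S (T_E^n (P⁻¹ e))) + T_F^n (Q⁻¹ f) ). -/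
open ContinuousLinearMap

variable (E F : Type*) [NormedAddCommGroup E] [NormedSpace ℂ E] [CompleteSpace E]
  [NormedAddCommGroup F] [NormedSpace ℂ F] [CompleteSpace F]

/-- The `n`-th term of the multiple scattering expansion of the inverse of the block
operator `𝒮(e, f) = (P e + R f, S e + Q f)`, namely the operator
`(e, f) ↦ (T_E^n (P⁻¹ e) − P⁻¹ (R (T_F^n (Q⁻¹ f))), −Q⁻¹ (S (T_E^n (P⁻¹ e))) + T_F^n (Q⁻¹ f))`
where `T_E = P⁻¹ ∘ R ∘ Q⁻¹ ∘ S` and `T_F = Q⁻¹ ∘ S ∘ P⁻¹ ∘ R`. -/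
noncomputable def scatteringTerm (P : E ≃L[ℂ] E) (Q : F ≃L[ℂ] F)
    (R : F →L[ℂ] E) (S : E →L[ℂ] F) (n : ℕ) : E × F →L[ℂ] E × F :=
  let Pi : E →L[ℂ] E := P.symm
  let Qi : F →L[ℂ] F := Q.symm
  let TE : E →L[ℂ] E := Pi.comp (R.comp (Qi.comp S))
  let TF : F →L[ℂ] F := Qi.comp (S.comp (Pi.comp R))
  (((TE ^ n).comp Pi).comp (fst ℂ E F)
      - ((Pi.comp (R.comp ((TF ^ n).comp Qi))).comp (snd ℂ E F))).prod
    (-(((Qi.comp (S.comp ((TE ^ n).comp Pi))).comp (fst ℂ E F)))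
      + ((TF ^ n).comp Qi).comp (snd ℂ E F))

/-- In a complete normed ring, the geometric series of an element of norm `< 1` converges to a
two-sided inverse of `1 - T`. -/
theorem exists_hasSum_pow_and_inverse {A : Type*} [NormedRing A] [HasSummableGeomSeries A]
    {T : A} (hT : ‖T‖ < 1) :
    ∃ N : A, HasSum (fun n : ℕ => T ^ n) N ∧ (1 - T) * N = 1 ∧ N * (1 - T) = 1 :=
  ⟨∑' n : ℕ, T ^ n, (summable_geometric_of_norm_lt_one hT).hasSum,
    mul_neg_geom_series T hT, geom_series_mul_neg T hT⟩

/-- Pre- and post-composition with fixed continuous linear maps preserves sums in operator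
norm. -/
theorem HasSum.clm_comp_comp {ι 𝕜 V W X Y : Type*} [NontriviallyNormedField 𝕜]
    [NormedAddCommGroup V] [NormedSpace 𝕜 V] [NormedAddCommGroup W] [NormedSpace 𝕜 W]
    [NormedAddCommGroup X] [NormedSpace 𝕜 X] [NormedAddCommGroup Y] [NormedSpace 𝕜 Y]
    {f : ι → W →L[𝕜] X} {a : W →L[𝕜] X} (hf : HasSum f a)
    (u : X →L[𝕜] Y) (v : V →L[𝕜] W) :
    HasSum (fun i => u.comp ((f i).comp v)) (u.comp (a.comp v)) :=
  ((compL 𝕜 V X Y u).comp ((compL 𝕜 V W X).flip v)).hasSum hf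

/-- **Multiple scattering expansion of the block single-layer operator.** If the two
reflection operators `T_E = P⁻¹ ∘ R ∘ Q⁻¹ ∘ S` and `T_F = Q⁻¹ ∘ S ∘ P⁻¹ ∘ R` have
operator norm `< 1`, then the block operator `𝒮(e, f) = (P e + R f, S e + Q f)` is
invertible, and its inverse is the sum (convergent in operator norm) of the multiple
scattering series. -/
theorem block_operator_multiple_scattering_expansion
    (P : E ≃L[ℂ] E) (Q : F ≃L[ℂ] F) (R : F →L[ℂ] E) (S : E →L[ℂ] F)
    (hTE : ‖((P.symm : E →L[ℂ] E).comp (R.comp ((Q.symm : F →L[ℂ] F).comp S)))‖ < 1)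
    (hTF : ‖((Q.symm : F →L[ℂ] F).comp (S.comp ((P.symm : E →L[ℂ] E).comp R)))‖ < 1)
    (𝒮 : E × F →L[ℂ] E × F)
    (h𝒮 : ∀ (e : E) (f : F), 𝒮 (e, f) = (P e + R f, S e + Q f)) :
    ∃ Sinv : E × F →L[ℂ] E × F,
      Sinv.comp 𝒮 = ContinuousLinearMap.id ℂ (E × F) ∧
      𝒮.comp Sinv = ContinuousLinearMap.id ℂ (E × F) ∧
      HasSum (fun n : ℕ => scatteringTerm E F P Q R S n) Sinv := by
  obtain ⟨A, hA, hA₁, hA₂⟩ := exists_hasSum_pow_and_inverse hTE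
  obtain ⟨B, hB, hB₁, -⟩ := exists_hasSum_pow_and_inverse hTF
  set Pi : E →L[ℂ] E := (P.symm : E →L[ℂ] E) with hPi
  set Qi : F →L[ℂ] F := (Q.symm : F →L[ℂ] F) with hQi
  have hA₁' (e : E) : P (A e) - R (Qi (S (A e))) = P e := by
    have h := congrArg P (DFunLike.congr_fun hA₁ e)
    simpa [hPi, hQi] using h
  have hB₁' (f : F) : Q (B f) - S (Pi (R (B f))) = Q f := by
    have h := congrArg Q (DFunLike.congr_fun hB₁ f)
    simpa [hPi, hQi] using h
  set U : E →L[ℂ] E × F := (ContinuousLinearMap.id ℂ E).prod (-(Qi.comp S)) with hU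
  set V : F →L[ℂ] E × F := (-(Pi.comp R)).prod (ContinuousLinearMap.id ℂ F) with hV
  have hright (x : E × F) :
      𝒮 (U (A (Pi x.1)) + V (B (Qi x.2))) = x := by
    have h₁ : 𝒮 (U (A (Pi x.1))) = (x.1, 0) := by
      have h := hA₁' (Pi x.1)
      simp only [hU, prod_apply, h𝒮]
      ext <;> simp_all [sub_eq_add_neg]
    have h₂ : 𝒮 (V (B (Qi x.2))) = (0, x.2) := by
      have h := hB₁' (Qi x.2)
      simp only [hV, prod_apply, h𝒮]
      ext <;> simp_all [sub_eq_add_neg, add_comm]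
    rw [map_add, h₁, h₂]
    simp
  have hinj : Function.Injective 𝒮 := by
    refine (injective_iff_map_eq_zero 𝒮).2 ?_
    rintro ⟨e, f⟩ h
    rw [h𝒮, Prod.mk_eq_zero] at h
    have hf : f = -Qi (S e) := by
      have := congrArg Q.symm (eq_neg_of_add_eq_zero_right h.2)
      simpa [hQi] using this
    have he : e = Pi (R (Qi (S e))) := by
      have := congrArg P.symm (eq_neg_of_add_eq_zero_left h.1)
      rw [hf] at this
      simpa [hPi] using this
    have he₀ : e = 0 := by
      have h' := DFunLike.congr_fun hA₂ e
      have h'' : (1 - Pi.comp (R.comp (Qi.comp S))) e = 0 := by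
        simpa [sub_eq_zero] using he
      rw [mul_def, comp_apply, h'', map_zero] at h'
      exact h'.symm
    simp [hf, he₀]
  refine ⟨U.comp (A.comp (Pi.comp (fst ℂ E F))) + V.comp (B.comp (Qi.comp (snd ℂ E F))),
    ?_, ?_, ?_⟩
  · exact ContinuousLinearMap.ext fun x => hinj (hright (𝒮 x))
  · exact ContinuousLinearMap.ext hright
  · convert (hA.clm_comp_comp U (Pi.comp (fst ℂ E F))).add
      (hB.clm_comp_comp V (Qi.comp (snd ℂ E F))) using 2 with n
    refine ContinuousLinearMap.ext fun x => Prod.ext ?_ ?_ <;>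
      simp [scatteringTerm, hU, hV, hPi, hQi, sub_eq_add_neg]
end

section
/- Let E and F be complex Banach spaces, P : E ≃L[ℂ] E and Q : F ≃L[ℂ] F continuous linear equivalences, R : F →L[ℂ] E and S : E →L[ℂ] F continuous linear maps, T_E := P⁻¹ ∘ R ∘ Q⁻¹ ∘ S and T_F := Q⁻¹ ∘ S ∘ P⁻¹ ∘ R, and suppose ε := max(‖T_E‖, ‖T_F‖) < 1. Let 𝒮(e,f) = (P e + R f, S e + Q f) and, for K ≥ 1, let P_K denote the partial sum operator P_K(e,f) = ∑_{n=0}^{K−1} ( T_E^n (P⁻¹ e) − P⁻¹(R(T_F^n (Q⁻¹ f))), −Q⁻¹(S(T_E^n (P⁻¹ e))) + T_F^n (Q⁻¹ f) ). Then 𝒮 is invertible and ‖𝒮⁻¹ − P_K‖ ≤ (ε^K / (1 − ε)) · (‖P⁻¹‖ + ‖Q⁻¹‖) · (1 + ‖P⁻¹ ∘ R‖ + ‖Q⁻¹ ∘ S‖). -/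
open ContinuousLinearMap

variable (E F : Type*) [NormedAddCommGroup E] [NormedSpace ℂ E] [CompleteSpace E]
  [NormedAddCommGroup F] [NormedSpace ℂ F] [CompleteSpace F]

/-- If `‖x ^ 2‖ < 1` in a complete normed ring, then `1 + x` is invertible with inverse
`(1 - x) * ∑ x ^ (2 n)`. -/
theorem exists_inverse_one_add_and_truncation_bound {A : Type*} [NormedRing A] [CompleteSpace A]
    (h1 : ‖(1 : A)‖ ≤ 1) (x : A) (hx : ‖x ^ 2‖ < 1) :
    ∃ y : A, (1 + x) * y = 1 ∧ y * (1 + x) = 1 ∧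
      ∀ K : ℕ, ‖y - (1 - x) * ∑ n ∈ Finset.range K, (x ^ 2) ^ n‖ ≤
        (1 + ‖x‖) * (‖x ^ 2‖ ^ K / (1 - ‖x ^ 2‖)) := by
  obtain ⟨G, hG⟩ : ∃ G : A, G = ∑' n, (x ^ 2) ^ n := ⟨_, rfl⟩
  have hl : G * (1 - x ^ 2) = 1 := hG ▸ geom_series_mul_neg (x ^ 2) hx
  have hr : (1 - x ^ 2) * G = 1 := hG ▸ mul_neg_geom_series (x ^ 2) hx
  have hnorm : ‖G‖ ≤ (1 - ‖x ^ 2‖)⁻¹ := by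
    have := tsum_geometric_le_of_norm_lt_one (x ^ 2) hx
    rw [← hG] at this
    linarith
  have hright : (1 + x) * ((1 - x) * G) = 1 := by
    rw [← mul_assoc, show (1 + x) * (1 - x) = 1 - x ^ 2 by noncomm_ring, hr]
  have hleft : (G * (1 - x)) * (1 + x) = 1 := by
    rw [mul_assoc, show (1 - x) * (1 + x) = 1 - x ^ 2 by noncomm_ring, hl]
  refine ⟨(1 - x) * G, hright, ?_, fun K => ?_⟩
  · rw [← left_inv_eq_right_inv hleft hright, hleft]
  · have hsum : ∑ n ∈ Finset.range K, (x ^ 2) ^ n = G - (x ^ 2) ^ K * G := by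
      calc ∑ n ∈ Finset.range K, (x ^ 2) ^ n
          = ((∑ n ∈ Finset.range K, (x ^ 2) ^ n) * (1 - x ^ 2)) * G := by
            rw [mul_assoc, hr, mul_one]
        _ = G - (x ^ 2) ^ K * G := by rw [geom_sum_mul_neg, sub_mul, one_mul]
    have hpow : ‖(x ^ 2) ^ K‖ ≤ ‖x ^ 2‖ ^ K := by
      rcases Nat.eq_zero_or_pos K with rfl | hK
      · simpa using h1
      · exact norm_pow_le' _ hK
    have hone : ‖1 - x‖ ≤ 1 + ‖x‖ := (norm_sub_le _ _).trans (by gcongr)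
    rw [hsum, ← mul_sub, sub_sub_cancel, div_eq_mul_inv]
    calc ‖(1 - x) * ((x ^ 2) ^ K * G)‖ ≤ ‖1 - x‖ * (‖(x ^ 2) ^ K‖ * ‖G‖) :=
          (norm_mul_le _ _).trans (by gcongr; exact norm_mul_le _ _)
      _ ≤ _ := by gcongr

/-- **Quantified truncation of the multiple scattering expansion.** With
`ε = max(‖T_E‖, ‖T_F‖) < 1`, the block operator `𝒮` is invertible and the truncation of
the multiple scattering series after `K` terms approximates `𝒮⁻¹` up to
`ε^K/(1 − ε) · (‖P⁻¹‖ + ‖Q⁻¹‖) · (1 + ‖P⁻¹ ∘ R‖ + ‖Q⁻¹ ∘ S‖)` in operator norm. -/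
theorem block_operator_scattering_truncation_bound
    (P : E ≃L[ℂ] E) (Q : F ≃L[ℂ] F) (R : F →L[ℂ] E) (S : E →L[ℂ] F)
    (hε : max ‖((P.symm : E →L[ℂ] E).comp (R.comp ((Q.symm : F →L[ℂ] F).comp S)))‖
            ‖((Q.symm : F →L[ℂ] F).comp (S.comp ((P.symm : E →L[ℂ] E).comp R)))‖ < 1)
    (𝒮 : E × F →L[ℂ] E × F)
    (h𝒮 : ∀ (e : E) (f : F), 𝒮 (e, f) = (P e + R f, S e + Q f))
    (K : ℕ) (hK : 1 ≤ K) :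
    ∃ Sinv : E × F →L[ℂ] E × F,
      Sinv.comp 𝒮 = ContinuousLinearMap.id ℂ (E × F) ∧
      𝒮.comp Sinv = ContinuousLinearMap.id ℂ (E × F) ∧
      ‖Sinv - ∑ n ∈ Finset.range K, scatteringTerm E F P Q R S n‖ ≤
        (max ‖((P.symm : E →L[ℂ] E).comp (R.comp ((Q.symm : F →L[ℂ] F).comp S)))‖
              ‖((Q.symm : F →L[ℂ] F).comp (S.comp ((P.symm : E →L[ℂ] E).comp R)))‖) ^ K /
          (1 - max ‖((P.symm : E →L[ℂ] E).comp (R.comp ((Q.symm : F →L[ℂ] F).comp S)))‖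
                ‖((Q.symm : F →L[ℂ] F).comp (S.comp ((P.symm : E →L[ℂ] E).comp R)))‖) *
          (‖(P.symm : E →L[ℂ] E)‖ + ‖(Q.symm : F →L[ℂ] F)‖) *
          (1 + ‖(P.symm : E →L[ℂ] E).comp R‖ + ‖(Q.symm : F →L[ℂ] F).comp S‖) := by
  obtain ⟨A, hA⟩ : ∃ A : F →L[ℂ] E, A = (P.symm : E →L[ℂ] E).comp R := ⟨_, rfl⟩
  obtain ⟨B, hB⟩ : ∃ B : E →L[ℂ] F, B = (Q.symm : F →L[ℂ] F).comp S := ⟨_, rfl⟩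
  have hTE : (P.symm : E →L[ℂ] E).comp (R.comp ((Q.symm : F →L[ℂ] F).comp S)) = A.comp B := by
    rw [hA, hB, comp_assoc]
  have hTF : (Q.symm : F →L[ℂ] F).comp (S.comp ((P.symm : E →L[ℂ] E).comp R)) = B.comp A := by
    rw [hA, hB, comp_assoc]
  rw [← hA, ← hB, hB, hTE, hA, hTF, ← hA, ← hB]
  rw [hTE, hTF] at hε
  obtain ⟨ε, hεdef⟩ : ∃ ε : ℝ, ε = max ‖A.comp B‖ ‖B.comp A‖ := ⟨_, rfl⟩
  rw [← hεdef] at hε ⊢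
  have hε0 : 0 ≤ ε := hεdef ▸ (norm_nonneg _).trans (le_max_left _ _)
  let N : E × F →L[ℂ] E × F := (A.comp (snd ℂ E F)).prod (B.comp (fst ℂ E F))
  let D : E × F →L[ℂ] E × F := (P : E →L[ℂ] E).prodMap (Q : F →L[ℂ] F)
  let Di : E × F →L[ℂ] E × F := (P.symm : E →L[ℂ] E).prodMap (Q.symm : F →L[ℂ] F)
  have hN2 : N ^ 2 = (A.comp B).prodMap (B.comp A) := by
    ext v <;> simp [N, pow_two]
  have hN2pow (n : ℕ) : (N ^ 2) ^ n = ((A.comp B) ^ n).prodMap ((B.comp A) ^ n) := by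
    rw [hN2]
    induction n with
    | zero => ext v <;> simp
    | succ n ih => rw [pow_succ, ih, pow_succ, pow_succ]; ext v <;> simp
  have hN2norm : ‖N ^ 2‖ ≤ ε := by
    refine opNorm_le_bound _ hε0 fun v => ?_
    rw [hN2]
    refine max_le ((le_opNorm (A.comp B) v.1).trans ?_) ((le_opNorm (B.comp A) v.2).trans ?_)
    · exact mul_le_mul (hεdef ▸ le_max_left _ _) (norm_fst_le v) (norm_nonneg _) hε0
    · exact mul_le_mul (hεdef ▸ le_max_right _ _) (norm_snd_le v) (norm_nonneg _) hε0
  have hNnorm : ‖N‖ ≤ ‖A‖ + ‖B‖ := by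
    refine opNorm_le_bound _ (by positivity) fun v => ?_
    refine max_le ((le_opNorm A v.2).trans ?_) ((le_opNorm B v.1).trans ?_)
    · exact mul_le_mul (by simp) (norm_snd_le v) (norm_nonneg _) (by positivity)
    · exact mul_le_mul (by simp) (norm_fst_le v) (norm_nonneg _) (by positivity)
  have hDinorm : ‖Di‖ ≤ ‖(P.symm : E →L[ℂ] E)‖ + ‖(Q.symm : F →L[ℂ] F)‖ := by
    refine opNorm_le_bound _ (by positivity) fun v => ?_
    refine max_le ((le_opNorm (P.symm : E →L[ℂ] E) v.1).trans ?_)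
      ((le_opNorm (Q.symm : F →L[ℂ] F) v.2).trans ?_)
    · exact mul_le_mul (by simp) (norm_fst_le v) (norm_nonneg _) (by positivity)
    · exact mul_le_mul (by simp) (norm_snd_le v) (norm_nonneg _) (by positivity)
  have hDDi : D * Di = 1 := by ext v <;> simp [D, Di]
  have hDiD : Di * D = 1 := by ext v <;> simp [D, Di]
  have hS : 𝒮 = D * (1 + N) := by
    refine ContinuousLinearMap.ext fun ⟨e, f⟩ => ?_
    rw [h𝒮]
    simp [D, N, hA, hB, add_comm]
  have hterm (n : ℕ) : scatteringTerm E F P Q R S n = (1 - N) * (N ^ 2) ^ n * Di := by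
    rw [hN2pow]
    refine ContinuousLinearMap.ext fun ⟨e, f⟩ => ?_
    simp only [scatteringTerm, hTE, hTF]
    simp [N, Di, hA, hB, sub_eq_add_neg, add_comm]
  obtain ⟨y, hy, hy', hbound⟩ := exists_inverse_one_add_and_truncation_bound
    (A := E × F →L[ℂ] E × F) norm_id_le N (hN2norm.trans_lt hε)
  refine ⟨y * Di, ?_, ?_, ?_⟩
  · change y * Di * 𝒮 = 1
    rw [hS, mul_assoc, ← mul_assoc Di, hDiD, one_mul, hy']
  · change 𝒮 * (y * Di) = 1
    rw [hS, mul_assoc, ← mul_assoc _ y, hy, one_mul, hDDi]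
  · simp_rw [hterm]
    rw [← Finset.sum_mul, ← Finset.mul_sum, ← sub_mul]
    have h1ε : 0 < 1 - ε := sub_pos.2 hε
    have hquot : 0 ≤ ‖N ^ 2‖ ^ K / (1 - ‖N ^ 2‖) :=
      div_nonneg (by positivity) (by linarith)
    calc _ ≤ (1 + ‖N‖) * (‖N ^ 2‖ ^ K / (1 - ‖N ^ 2‖)) * ‖Di‖ :=
          (norm_mul_le _ _).trans (by gcongr; exact hbound K)
      _ ≤ (1 + (‖A‖ + ‖B‖)) * (ε ^ K / (1 - ε)) *
          (‖(P.symm : E →L[ℂ] E)‖ + ‖(Q.symm : F →L[ℂ] F)‖) := by gcongr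
      _ = _ := by ring
end

section
/- Let E and F be complex Banach spaces, P : E ≃L[ℂ] E and Q : F ≃L[ℂ] F continuous linear equivalences, R : F →L[ℂ] E, S : E →L[ℂ] F, T_E := P⁻¹ ∘ R ∘ Q⁻¹ ∘ S with ‖T_E‖ < 1 and T_F := Q⁻¹ ∘ S ∘ P⁻¹ ∘ R with ‖T_F‖ < 1, and let 𝒮(e,f) = (P e + R f, S e + Q f). Let A₁₁ : E →L[ℂ] E be the (1,1)-component of 𝒮⁻¹, i.e. A₁₁ e = the first component of 𝒮⁻¹(e, 0). Then A₁₁ = ∑_{n=0}^∞ T_E^n ∘ P⁻¹ (convergent in operator norm), and the first-order truncation satisfies ‖A₁₁ − P⁻¹ − T_E ∘ P⁻¹‖ ≤ ‖T_E‖² · ‖P⁻¹‖ / (1 − ‖T_E‖). -/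
open ContinuousLinearMap

/-- The Neumann series of a fixed-point equation `A = B + T ∘ A` with `‖T‖ < 1`. -/
theorem hasSum_pow_comp_of_eq_add_comp {𝕜 V W : Type*} [NontriviallyNormedField 𝕜]
    [NormedAddCommGroup V] [NormedSpace 𝕜 V] [NormedAddCommGroup W] [NormedSpace 𝕜 W]
    [CompleteSpace W] {T : W →L[𝕜] W} {A B : V →L[𝕜] W} (hT : ‖T‖ < 1) (h : A = B + T.comp A) :
    HasSum (fun n : ℕ => (T ^ n).comp B) A := by
  have hsum := (summable_geometric_of_norm_lt_one hT).hasSum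
  have hB : B = (1 - T).comp A := by
    rw [sub_comp, one_def, id_comp]
    exact eq_sub_of_add_eq h.symm
  have hA : (∑' n : ℕ, T ^ n).comp B = A := by
    rw [hB, ← comp_assoc, ← mul_def, geom_series_mul_neg T hT, one_def, id_comp]
  rw [← hA]
  exact ((compL 𝕜 V W W).flip B).hasSum hsum

theorem norm_sub_sub_comp_le_of_eq_add_comp {𝕜 V W : Type*} [NontriviallyNormedField 𝕜]
    [NormedAddCommGroup V] [NormedSpace 𝕜 V] [NormedAddCommGroup W] [NormedSpace 𝕜 W]
    {T : W →L[𝕜] W} {A B : V →L[𝕜] W} (hT : ‖T‖ < 1) (h : A = B + T.comp A) :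
    ‖A - B - T.comp B‖ ≤ ‖T‖ ^ 2 * ‖B‖ / (1 - ‖T‖) := by
  have hpos : 0 < 1 - ‖T‖ := sub_pos.2 hT
  have hrem : A - B - T.comp B = T.comp (T.comp A) := by
    have h' : A - B = T.comp A := sub_eq_of_eq_add' h
    rw [h', ← comp_sub, h']
  have hA : ‖A‖ ≤ ‖B‖ / (1 - ‖T‖) := by
    have hle : ‖A‖ ≤ ‖B‖ + ‖T‖ * ‖A‖ :=
      calc ‖A‖ = ‖B + T.comp A‖ := congrArg _ h
        _ ≤ ‖B‖ + ‖T.comp A‖ := norm_add_le _ _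
        _ ≤ ‖B‖ + ‖T‖ * ‖A‖ := by gcongr; exact opNorm_comp_le _ _
    rw [le_div_iff₀ hpos]
    linarith
  calc ‖A - B - T.comp B‖ = ‖T.comp (T.comp A)‖ := congrArg _ hrem
    _ ≤ ‖T‖ * ‖T.comp A‖ := opNorm_comp_le _ _
    _ ≤ ‖T‖ * (‖T‖ * ‖A‖) := by gcongr; exact opNorm_comp_le _ _
    _ ≤ ‖T‖ * (‖T‖ * (‖B‖ / (1 - ‖T‖))) := by gcongr
    _ = ‖T‖ ^ 2 * ‖B‖ / (1 - ‖T‖) := by ring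

/-- **Expansion of the (1,1)-component of the inverse block operator.** If the reflection
operators `T_E = P⁻¹ ∘ R ∘ Q⁻¹ ∘ S` and `T_F = Q⁻¹ ∘ S ∘ P⁻¹ ∘ R` have norm `< 1`, if
`Sinv` is the (two-sided) inverse of the block operator `𝒮(e, f) = (P e + R f, S e + Q f)`,
and if `A₁₁ e = (Sinv (e, 0)).1` is the `(1,1)`-component of `𝒮⁻¹`, then
`A₁₁ = ∑ₙ T_E^n ∘ P⁻¹` in operator norm and the first-order truncation satisfies
`‖A₁₁ − P⁻¹ − T_E ∘ P⁻¹‖ ≤ ‖T_E‖² ‖P⁻¹‖ / (1 − ‖T_E‖)`. -/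
theorem inverse_block_operator_component_expansion
    (E F : Type*) [NormedAddCommGroup E] [NormedSpace ℂ E] [CompleteSpace E]
    [NormedAddCommGroup F] [NormedSpace ℂ F] [CompleteSpace F]
    (P : E ≃L[ℂ] E) (Q : F ≃L[ℂ] F) (R : F →L[ℂ] E) (S : E →L[ℂ] F)
    (hTE : ‖((P.symm : E →L[ℂ] E).comp (R.comp ((Q.symm : F →L[ℂ] F).comp S)))‖ < 1)
    (hTF : ‖((Q.symm : F →L[ℂ] F).comp (S.comp ((P.symm : E →L[ℂ] E).comp R)))‖ < 1)
    (𝒮 : E × F →L[ℂ] E × F)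
    (h𝒮 : ∀ (e : E) (f : F), 𝒮 (e, f) = (P e + R f, S e + Q f))
    (Sinv : E × F →L[ℂ] E × F)
    (hSinv₁ : Sinv.comp 𝒮 = ContinuousLinearMap.id ℂ (E × F))
    (hSinv₂ : 𝒮.comp Sinv = ContinuousLinearMap.id ℂ (E × F))
    (A₁₁ : E →L[ℂ] E) (hA : ∀ e : E, A₁₁ e = (Sinv (e, 0)).1) :
    HasSum (fun n : ℕ =>
        ((((P.symm : E →L[ℂ] E).comp (R.comp ((Q.symm : F →L[ℂ] F).comp S))) ^ n).comp
          (P.symm : E →L[ℂ] E))) A₁₁ ∧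
    ‖A₁₁ - (P.symm : E →L[ℂ] E) -
        ((P.symm : E →L[ℂ] E).comp (R.comp ((Q.symm : F →L[ℂ] F).comp S))).comp
          (P.symm : E →L[ℂ] E)‖ ≤
      ‖((P.symm : E →L[ℂ] E).comp (R.comp ((Q.symm : F →L[ℂ] F).comp S)))‖ ^ 2 *
        ‖(P.symm : E →L[ℂ] E)‖ /
        (1 - ‖((P.symm : E →L[ℂ] E).comp (R.comp ((Q.symm : F →L[ℂ] F).comp S)))‖) := by
  have h : A₁₁ = (P.symm : E →L[ℂ] E) +
      ((P.symm : E →L[ℂ] E).comp (R.comp ((Q.symm : F →L[ℂ] F).comp S))).comp A₁₁ := by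
    ext e
    obtain ⟨a, f, haf⟩ : ∃ a f, Sinv (e, 0) = (a, f) := ⟨_, _, rfl⟩
    have hS : 𝒮 (Sinv (e, 0)) = (e, 0) := DFunLike.congr_fun hSinv₂ (e, 0)
    rw [haf, h𝒮, Prod.mk.injEq] at hS
    obtain ⟨he, hf⟩ := hS
    have hQ : Q.symm (S a) = -f := by
      rw [eq_neg_of_add_eq_zero_left hf, map_neg, Q.symm_apply_apply]
    have hAe : A₁₁ e = a := by rw [hA, haf]
    have hPe : P.symm e = a + P.symm (R f) := by
      rw [← he, map_add, P.symm_apply_apply]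
    simp [hAe, hQ, hPe]
  exact ⟨hasSum_pow_comp_of_eq_add_comp hTE h, norm_sub_sub_comp_le_of_eq_add_comp hTE h⟩
end

section
/- Let n be a nonempty finite index type and A ∈ Matrix n n ℂ. Suppose λ ∈ ℂ is a simple eigenvalue of A, i.e. λ is a root of the characteristic polynomial of A of multiplicity exactly 1. Let x ∈ (n → ℂ) be a nonzero right eigenvector, A.mulVec x = λ • x, and let y ∈ (n → ℂ) be a nonzero left eigenvector, i.e. Aᴴ.mulVec y = (conj λ) • y, where Aᴴ is the conjugate transpose. Then star y ⬝ᵥ x = ∑_i conj(y i) · (x i) ≠ 0. -/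
open Matrix

/-- If the eigenvalue `μ` of `f` has algebraic multiplicity one, a linear form `g` which is a
left eigenvector for `μ` and vanishes on a nonzero right eigenvector is zero. -/
theorem Module.End.eq_zero_of_comp_eq_smul_of_rootMultiplicity_eq_one
    {K V : Type*} [Field K] [AddCommGroup V] [Module K V] [FiniteDimensional K V]
    {f : Module.End K V} {μ : K} (hμ : (LinearMap.charpoly f).rootMultiplicity μ = 1)
    {x : V} (hx : x ≠ 0) (hfx : f x = μ • x)
    {g : V →ₗ[K] K} (hg : ∀ v, g (f v) = μ * g v) (hgx : g x = 0) : g = 0 := by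
  have hxmem : x ∈ f.maxGenEigenspace μ :=
    (Module.End.mem_maxGenEigenspace f μ x).2 ⟨1, by simp [hfx]⟩
  have hrank : Module.finrank K (f.maxGenEigenspace μ) = 1 := by
    rw [LinearMap.finrank_maxGenEigenspace_eq, hμ]
  have hspan := (finrank_eq_one_iff_of_nonzero' (⟨x, hxmem⟩ : f.maxGenEigenspace μ)
    (by simpa [Subtype.ext_iff] using hx)).1 hrank
  have hcompl := LinearMap.isCompl_iSup_ker_pow_iInf_range_pow (f - μ • 1)
  ext v
  obtain ⟨m, hm, r, hr, rfl⟩ := Submodule.mem_sup.1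
    (hcompl.sup_eq_top.symm ▸ Submodule.mem_top : v ∈ _)
  have hm' : m ∈ f.maxGenEigenspace μ :=
    (iSup_le fun k _ hv => (Module.End.mem_maxGenEigenspace f μ _).2 ⟨k, hv⟩ :
      (⨆ k : ℕ, LinearMap.ker ((f - μ • 1) ^ k)) ≤ f.maxGenEigenspace μ) hm
  obtain ⟨c, hc⟩ := hspan ⟨m, hm'⟩
  obtain ⟨z, rfl⟩ := (Submodule.mem_iInf _).1 hr 1
  have hcm : c • x = m := congrArg Subtype.val hc
  simp [← hcm, hgx, hg]

/-- **Non-orthogonality of left and right eigenvectors at a simple eigenvalue.** If `λ` is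
a simple eigenvalue of `A ∈ Matrix n n ℂ` (a root of the characteristic polynomial of
multiplicity exactly `1`), `x` is a nonzero right eigenvector and `y` a nonzero left
eigenvector, then the Hermitian pairing `y* x = ∑ᵢ conj(yᵢ) xᵢ` is nonzero. -/
theorem left_right_eigenvector_pairing_ne_zero
    (n : Type*) [Fintype n] [DecidableEq n] [Nonempty n]
    (A : Matrix n n ℂ) (lam : ℂ)
    (hsimple : A.charpoly.rootMultiplicity lam = 1)
    (x : n → ℂ) (hx : x ≠ 0) (hAx : A.mulVec x = lam • x)
    (y : n → ℂ) (hy : y ≠ 0) (hAy : Aᴴ.mulVec y = (starRingEnd ℂ) lam • y) :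
    star y ⬝ᵥ x ≠ 0 := by
  intro h
  have hleft : star y ᵥ* A = lam • star y := by
    simpa [star_mulVec] using congrArg star hAy
  have hzero : dotProductBilin ℂ ℂ (star y) = 0 :=
    Module.End.eq_zero_of_comp_eq_smul_of_rootMultiplicity_eq_one
      (f := Matrix.toLin' A) (by rwa [Matrix.charpoly_toLin']) hx (by simpa using hAx)
      (fun v => by simp [dotProduct_mulVec, hleft]) h
  refine hy (star_eq_zero.1 (dotProduct_eq_zero _ fun v => ?_))
  exact LinearMap.congr_fun hzero v
end
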